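/- For every t ∈ ℂ, the free-kinetic-energy evolution satisfies exp(itP²) = Σ_{m,n ≥ 0} I²_{m,n}(t) · S^m T^n (operator-norm absolutely convergent double series), where I²_{m,n}(t) := 0 if m+n is odd, and I²_{m,n}(t) := (−1)^{(3m+n)/2} · Σ_{p≥0} (it)^{(m+n)/2 + p}/((m+n)/2 + p)! · (m+n+1)/(2p+m+n+1) · binom(2p+m+n+1, p) if m+n is even. -/

import Mathlib

open scoped InnerProductSpace

/-- The coefficients `I²_{m,n}(t)`: zero if `m+n` is odd, and
`(-1)^{(3m+n)/2} Σ_{p≥0} (it)^{(m+n)/2+p}/((m+n)/2+p)! · (m+n+1)/(2p+m+n+1) · C(2p+m+n+1,p)`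
if `m+n` is even. -/
noncomputable def I2coef (m n : ℕ) (t : ℂ) : ℂ :=
  if (m + n) % 2 = 1 then 0
  else
    (-1) ^ ((3 * m + n) / 2) *
      ∑' p : ℕ,
        (Complex.I * t) ^ ((m + n) / 2 + p) / (Nat.factorial ((m + n) / 2 + p) : ℂ) *
          (((m : ℂ) + n + 1) / (2 * (p : ℂ) + m + n + 1)) *
          (Nat.choose (2 * p + m + n + 1) p : ℂ)

/-- Ballot numbers. -/
def bal : ℕ → ℕ → ℕ
  | 0, 0 => 1
  | 0, _ + 1 => 0
  | k + 1, 0 => bal k 1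
  | k + 1, l + 1 => bal k l + bal k (l + 2)

lemma bal_zero_of_lt (k : ℕ) : ∀ l, k < l → bal k l = 0 := by
  induction k with
  | zero => intro l hl; cases l with
    | zero => omega
    | succ l => rfl
  | succ k ih => intro l hl; cases l with
    | zero => omega
    | succ l => simp only [bal]; rw [ih l (by omega), ih (l+2) (by omega)]

lemma bal_zero_of_odd (k : ℕ) : ∀ l, (k + l) % 2 = 1 → bal k l = 0 := by
  induction k with
  | zero => intro l hl; cases l with
    | zero => omega
    | succ l => rfl
  | succ k ih => intro l hl; cases l with
    | zero => simp only [bal]; exact ih 1 (by omega)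
    | succ l => simp only [bal]; rw [ih l (by omega), ih (l+2) (by omega)]

lemma bal_le (k : ℕ) : ∀ l, (bal k l : ℝ) ≤ 4 ^ k * (1/2) ^ l := by
  induction k with
  | zero => intro l; cases l with
    | zero => simp [bal]
    | succ l => simp only [bal]; push_cast; positivity
  | succ k ih => intro l; cases l with
    | zero =>
      simp only [bal]
      have := ih 1
      have h4 : (0:ℝ) < 4 ^ k := by positivity
      rw [pow_succ]
      linarith
    | succ l =>
      simp only [bal]; push_cast
      have h1 := ih l
      have h2 := ih (l+2)
      have h4 : (0:ℝ) < 4 ^ k * (1/2) ^ l := by positivity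
      have e1 : (4:ℝ) ^ k * (1/2) ^ (l+2) = (4 ^ k * (1/2) ^ l) / 4 := by ring
      have e2 : (4:ℝ) ^ (k+1) * (1/2) ^ (l+1) = (4 ^ k * (1/2) ^ l) * 2 := by ring
      rw [e2]; rw [e1] at h2
      linarith

lemma bal_choose (k : ℕ) : ∀ l p, l + 2 * p = k →
    bal k l + Nat.choose k (p + l + 1) = Nat.choose k p := by
  induction k with
  | zero =>
    intro l p h
    obtain rfl : l = 0 := by omega
    obtain rfl : p = 0 := by omega
    simp [bal]
  | succ k ih =>
    intro l p h
    cases l with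
    | zero =>
      obtain ⟨q, rfl⟩ : ∃ q, p = q + 1 := ⟨p - 1, by omega⟩
      have := ih 1 q (by omega)
      simp only [bal]
      rw [show q + 1 + 0 + 1 = (q + 1) + 1 by ring, Nat.choose_succ_succ k (q+1),
        Nat.choose_succ_succ k q]
      simp only [Nat.succ_eq_add_one] at *
      omega
    | succ l =>
      simp only [bal]
      cases p with
      | zero =>
        have := ih l 0 (by omega)
        rw [bal_zero_of_lt k (l+2) (by omega)]
        rw [Nat.choose_eq_zero_of_lt (show k < 0 + l + 1 by omega)] at this
        rw [Nat.choose_eq_zero_of_lt (show k + 1 < 0 + (l + 1) + 1 by omega)]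
        simpa using this
      | succ p =>
        have h1 := ih l (p+1) (by omega)
        have h2 := ih (l+2) p (by omega)
        rw [show p + 1 + (l + 1) + 1 = (p + l + 2) + 1 by ring, Nat.choose_succ_succ,
          Nat.choose_succ_succ]
        rw [show p + 1 + l + 1 = p + l + 2 by ring] at h1
        rw [show p + (l + 2) + 1 = p + l + 2 + 1 by ring] at h2
        simp only [Nat.succ_eq_add_one] at *
        omega

lemma bal_closed (l p : ℕ) :
    bal (l + 2 * p) l * (2 * p + l + 1) = (l + 1) * Nat.choose (2 * p + l + 1) p := by
  have h := bal_choose (l + 2 * p) l p rfl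
  have s1 : Nat.choose (l + 2 * p + 1) (p + l + 1) = Nat.choose (l + 2 * p + 1) p :=
    Nat.choose_symm_of_eq_add (by omega)
  have s2 : Nat.choose (l + 2 * p) (p + l) = Nat.choose (l + 2 * p) p :=
    Nat.choose_symm_of_eq_add (by omega)
  have m1 := Nat.add_one_mul_choose_eq (l + 2 * p) (p + l)
  have m2 := Nat.choose_succ_succ (l + 2 * p) (p + l)
  simp only [Nat.succ_eq_add_one] at *
  rw [s1, s2] at m1 m2
  rw [show 2 * p + l + 1 = l + 2 * p + 1 by ring]
  zify at *
  generalize ((l + 2 * p + 1).choose p : ℤ) = X at *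
  generalize ((l + 2 * p).choose p : ℤ) = Y at *
  generalize ((l + 2 * p).choose (p + l + 1) : ℤ) = Z at *
  generalize (bal (l + 2 * p) l : ℤ) = b at *
  have hb : b = Y - Z := by linarith
  have hZ : Z = X - Y := by linarith
  subst hb; subst hZ
  linear_combination 2 * m1

lemma bal_closedC (m n p : ℕ) :
    (bal (m + n + 2 * p) (m + n) : ℂ) =
      (((m : ℂ) + n + 1) / (2 * (p : ℂ) + m + n + 1)) *
          (Nat.choose (2 * p + m + n + 1) p : ℂ) := by
  have h := bal_closed (m + n) p
  have h' : (bal (m + n + 2 * p) (m + n) : ℂ) * (2 * p + m + n + 1)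
      = (m + n + 1) * (Nat.choose (2 * p + m + n + 1) p : ℂ) := by
    rw [show 2 * p + (m + n) + 1 = 2 * p + m + n + 1 by ring] at h
    exact_mod_cast h
  have hne : (2 * (p : ℂ) + m + n + 1) ≠ 0 := by
    have : ((2 * p + m + n + 1 : ℕ) : ℂ) ≠ 0 := Nat.cast_ne_zero.mpr (by omega)
    push_cast at this; exact this
  field_simp
  linear_combination h'

section ring
variable {R : Type*} [Ring R] (A B : R)

/-- Chebyshev-like sums. -/
def Wsum (l : ℕ) : R := ∑ mn ∈ Finset.HasAntidiagonal.antidiagonal l, A ^ mn.1 * B ^ mn.2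

lemma Wsum_zero : Wsum A B 0 = 1 := by simp [Wsum]

lemma Wsum_one : Wsum A B 1 = A + B := by
  simp [Wsum, Finset.Nat.antidiagonal_succ, add_comm]

lemma Wsum_step (h : B * A = 1) (l : ℕ) :
    (A + B) * Wsum A B (l + 1) = Wsum A B (l + 2) + Wsum A B l := by
  rw [add_mul]
  have h1 : A * Wsum A B (l+1) + B ^ (l + 2) = Wsum A B (l + 2) := by
    unfold Wsum
    rw [Finset.Nat.antidiagonal_succ (n := l + 1)]
    simp only [Finset.sum_cons, Finset.sum_map, Finset.mul_sum]
    simp [pow_succ', mul_assoc, add_comm (B * _)]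
  have h2 : B * Wsum A B (l+1) = B ^ (l + 2) + Wsum A B l := by
    unfold Wsum
    rw [Finset.Nat.antidiagonal_succ (n := l)]
    have : ∀ x y : ℕ, B * (A ^ (x+1) * B ^ y) = A ^ x * B ^ y := by
      intro x y
      rw [pow_succ', mul_assoc, ← mul_assoc B A, h, one_mul]
    simp only [Finset.sum_cons, Finset.sum_map, mul_add, Finset.mul_sum]
    simp [this]
    rw [← pow_succ']
  rw [h2, ← h1]; abel

lemma pow_eq_bal (h : B * A = 1) (k : ℕ) :
    (A + B) ^ k = ∑ l ∈ Finset.range (k + 1), (bal k l : R) * Wsum A B l := by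
  induction k with
  | zero => simp [bal, Wsum_zero]
  | succ k ih =>
    rw [pow_succ', ih, Finset.mul_sum]
    have hc : ∀ l, (A + B) * ((bal k l : R) * Wsum A B l)
        = (bal k l : R) * ((A + B) * Wsum A B l) := by
      intro l
      rw [← mul_assoc, ← mul_assoc, (Nat.cast_commute (bal k l) (A + B)).eq]
    simp only [hc]
    rw [Finset.sum_range_succ']
    simp only [Wsum_step A B h, mul_add]
    rw [Finset.sum_add_distrib, Wsum_zero, mul_one, ← Wsum_one A B]
    rw [Finset.sum_range_succ' _ (k+1)]
    simp only [bal, Nat.cast_add, add_mul]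
    rw [Finset.sum_add_distrib]
    have e1 : ∑ l ∈ Finset.range (k+1), (bal k l : R) * Wsum A B (l+1)
        = ∑ l ∈ Finset.range k, (bal k (l+1) : R) * Wsum A B (l+2)
          + (bal k 0 : R) * Wsum A B 1 := by
      rw [Finset.sum_range_succ']
    have e2 : ∑ l ∈ Finset.range (k+1), (bal k (l+2) : R) * Wsum A B (l+1)
        + (bal k 1 : R) * Wsum A B 0
        = ∑ l ∈ Finset.range k, (bal k (l+1) : R) * Wsum A B l := by
      rw [← Finset.sum_range_succ' (fun l => (bal k (l+1) : R) * Wsum A B l) (k+1),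
        Finset.sum_range_succ, Finset.sum_range_succ, bal_zero_of_lt k (k+1+1) (by omega),
        bal_zero_of_lt k (k+1) (by omega)]
      simp
    rw [e1, ← e2]; abel

end ring

lemma hasSum_pow_bal {R : Type*} [NormedRing R] (A B : R) (h : B * A = 1) (k : ℕ) :
    HasSum (fun mn : ℕ × ℕ => (bal k (mn.1 + mn.2) : R) * (A ^ mn.1 * B ^ mn.2))
      ((A + B) ^ k) := by
  rw [← Finset.HasAntidiagonal.sigmaAntidiagonalEquivProd.hasSum_iff, pow_eq_bal A B h]
  have hs : ∑ l ∈ Finset.range (k + 1), (bal k l : R) * Wsum A B l =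
      ∑ x ∈ (Finset.range (k+1)).sigma
        (fun l => (Finset.univ : Finset (Finset.HasAntidiagonal.antidiagonal l))),
      ((fun mn : ℕ × ℕ => (bal k (mn.1 + mn.2) : R) * (A ^ mn.1 * B ^ mn.2)) ∘
        Finset.HasAntidiagonal.sigmaAntidiagonalEquivProd) x := by
    rw [Finset.sum_sigma]
    refine Finset.sum_congr rfl fun l _ => ?_
    rw [Wsum, Finset.mul_sum, ← Finset.sum_coe_sort]
    refine Finset.sum_congr rfl fun x _ => ?_
    have hx := Finset.HasAntidiagonal.mem_antidiagonal.mp x.2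
    simp [Finset.HasAntidiagonal.sigmaAntidiagonalEquivProd, hx]
  rw [hs]
  refine hasSum_sum_of_ne_finset_zero ?_
  rintro ⟨l, x⟩ hb
  have hx := Finset.HasAntidiagonal.mem_antidiagonal.mp x.2
  have hl : k < l := by
    by_contra hcon
    exact hb (by simp; omega)
  simp [Finset.HasAntidiagonal.sigmaAntidiagonalEquivProd, hx, bal_zero_of_lt k l hl]

lemma sign_eq (m n : ℕ) (h : ¬ (m + n) % 2 = 1) :
    (Complex.I ^ m * (-Complex.I) ^ n : ℂ) = (-1) ^ ((3 * m + n) / 2) := by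
  have h3 : (-Complex.I : ℂ) = Complex.I ^ 3 := by
    rw [pow_succ, Complex.I_sq]; ring
  have hI : (-1 : ℂ) = Complex.I ^ 2 := Complex.I_sq.symm
  rw [h3, ← pow_mul, ← pow_add, hI, ← pow_mul,
    show 2 * ((3 * m + n) / 2) = 3 * m + n by omega]
  rw [Complex.I_pow_eq_pow_mod (m + 3 * n), Complex.I_pow_eq_pow_mod (3 * m + n)]
  congr 1
  omega

lemma coef_hasSum (m n : ℕ) (t : ℂ)
    (hs : Summable fun j : ℕ => (Complex.I * t) ^ j / (Nat.factorial j : ℂ) *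
      (bal (2 * j) (m + n) : ℂ) * (Complex.I ^ m * (-Complex.I) ^ n)) :
    HasSum (fun j : ℕ => (Complex.I * t) ^ j / (Nat.factorial j : ℂ) *
      (bal (2 * j) (m + n) : ℂ) * (Complex.I ^ m * (-Complex.I) ^ n)) (I2coef m n t) := by
  have key : I2coef m n t = ∑' j : ℕ, (Complex.I * t) ^ j / (Nat.factorial j : ℂ) *
      (bal (2 * j) (m + n) : ℂ) * (Complex.I ^ m * (-Complex.I) ^ n) := by
    unfold I2coef
    split_ifs with h
    · have : ∀ j, bal (2 * j) (m + n) = 0 := fun j => bal_zero_of_odd _ _ (by omega)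
      simp [this]
    · rw [← hs.sum_add_tsum_nat_add ((m + n) / 2), Finset.sum_eq_zero, zero_add, ← tsum_mul_left]
      · refine tsum_congr fun p => ?_
        rw [sign_eq m n h, show 2 * (p + (m + n) / 2) = m + n + 2 * p by omega, bal_closedC,
          add_comm p]
        ring
      · intro j hj
        rw [Finset.mem_range] at hj
        rw [bal_zero_of_lt _ _ (by omega)]
        simp
  rw [key]
  exact hs.hasSum

lemma hasSum_smul_aux {E : Type*} [NormedAddCommGroup E] [NormedSpace ℂ E] {f : ℕ → ℂ} {a : ℂ}
    (h : HasSum f a) (x : E) : HasSum (fun j => f j • x) (a • x) :=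
  h.smul_const x

set_option maxHeartbeats 1000000 in
lemma main_aux {R : Type*} [NormedRing R] [NormedAlgebra ℂ R] [CompleteSpace R]
    (S T P : R) (hTS : T * S = 1) (hST : ∀ m n : ℕ, ‖S ^ m * T ^ n‖ ≤ 1)
    (hP : P = Complex.I • (S - T)) (t : ℂ) :
    HasSum (fun mn : ℕ × ℕ => I2coef mn.1 mn.2 t • (S ^ mn.1 * T ^ mn.2))
        (NormedSpace.exp ((Complex.I * t) • (P ^ 2))) ∧
      Summable (fun mn : ℕ × ℕ => ‖I2coef mn.1 mn.2 t • (S ^ mn.1 * T ^ mn.2)‖) := by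
  set c : ℕ → ℕ × ℕ → ℂ := fun j mn => (Complex.I * t) ^ j / (Nat.factorial j : ℂ) *
      (bal (2 * j) (mn.1 + mn.2) : ℂ) * (Complex.I ^ mn.1 * (-Complex.I) ^ mn.2) with hc
  set F : ℕ × (ℕ × ℕ) → (R) := fun x => c x.1 x.2 • (S ^ x.2.1 * T ^ x.2.2) with hF
  have hcb : ∀ j mn, ‖c j mn‖ ≤ (16 * ‖t‖) ^ j / (Nat.factorial j : ℝ) *
      ((1/2) ^ mn.1 * (1/2) ^ mn.2) := by
    intro j mn
    have hb := bal_le (2 * j) (mn.1 + mn.2)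
    have : ‖c j mn‖ = ‖t‖ ^ j / (Nat.factorial j : ℝ) * (bal (2 * j) (mn.1 + mn.2) : ℝ) := by
      simp [hc]
    rw [this]
    calc ‖t‖ ^ j / (Nat.factorial j : ℝ) * (bal (2 * j) (mn.1 + mn.2) : ℝ)
        ≤ ‖t‖ ^ j / (Nat.factorial j : ℝ) * (4 ^ (2 * j) * (1/2) ^ (mn.1 + mn.2)) := by
          gcongr
      _ = _ := by rw [pow_mul, pow_add, mul_pow]; norm_num; ring
  have hgeo : Summable fun mn : ℕ × ℕ => ((1/2 : ℝ)) ^ mn.1 * (1/2) ^ mn.2 :=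
    summable_geometric_two.mul_of_nonneg summable_geometric_two
      (fun _ => by positivity) (fun _ => by positivity)
  have hFn : Summable fun x => ‖F x‖ := by
    refine Summable.of_nonneg_of_le (fun _ => norm_nonneg _) ?_
      ((Real.summable_pow_div_factorial (16 * ‖t‖)).mul_of_nonneg hgeo
        (fun _ => by positivity) (fun _ => by positivity))
    intro x
    rw [hF, norm_smul]
    calc _ ≤ ‖c x.1 x.2‖ * 1 := by gcongr; exact hST _ _
      _ ≤ _ := by rw [mul_one]; exact hcb _ _
  have hcs : ∀ mn, Summable fun j => c j mn := by
    intro mn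
    refine Summable.of_norm_bounded ?_ (fun j => hcb j mn)
    exact (Real.summable_pow_div_factorial (16 * ‖t‖)).mul_right _
  have hFs : Summable F := hFn.of_norm
  have hfib : ∀ mn : ℕ × ℕ, HasSum (fun j => F (j, mn))
      (I2coef mn.1 mn.2 t • (S ^ mn.1 * T ^ mn.2)) := by
    intro mn
    have h1 : HasSum (fun j => c j mn) (I2coef mn.1 mn.2 t) :=
      coef_hasSum mn.1 mn.2 t (hcs mn)
    have h2 := hasSum_smul_aux h1 (S ^ mn.1 * T ^ mn.2)
    simp only [hF]
    exact h2
  have hAB : P = Complex.I • S + (-Complex.I) • T := by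
    rw [hP, smul_sub, neg_smul, sub_eq_add_neg]
  have hBA : ((-Complex.I) • T) * (Complex.I • S) = 1 := by
    rw [smul_mul_smul_comm, hTS]; simp
  have hrow : ∀ j : ℕ, HasSum (fun mn => F (j, mn))
      ((Nat.factorial j : ℂ)⁻¹ • ((Complex.I * t) • (P ^ 2)) ^ j) := by
    intro j
    have h := (hasSum_pow_bal (Complex.I • S) ((-Complex.I) • T) hBA (2 * j)).const_smul
      ((Complex.I * t) ^ j / (Nat.factorial j : ℂ))
    rw [← hAB] at h
    convert h using 1
    · funext mn
      simp only [hF, hc, smul_pow, smul_mul_smul_comm]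
      rw [← nsmul_eq_mul, ← Nat.cast_smul_eq_nsmul ℂ, smul_smul, smul_smul]
    · rw [smul_pow, smul_smul, pow_mul]
      congr 1
      ring
  have hexp := NormedSpace.exp_series_hasSum_exp' (𝕂 := ℂ) ((Complex.I * t) • (P ^ 2))
  have htot : HasSum F (NormedSpace.exp ((Complex.I * t) • (P ^ 2))) := by
    have h := hFs.hasSum
    rw [(h.prod_fiberwise hrow).unique hexp] at h
    exact h
  have hswap : HasSum (fun y : (ℕ × ℕ) × ℕ => F (y.2, y.1))
      (NormedSpace.exp ((Complex.I * t) • (P ^ 2))) :=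
    (Equiv.prodComm (ℕ × ℕ) ℕ).hasSum_iff.mpr htot
  refine ⟨hswap.prod_fiberwise hfib, ?_⟩
  have hnswap : Summable (fun y : (ℕ × ℕ) × ℕ => ‖F (y.2, y.1)‖) :=
    (Equiv.prodComm (ℕ × ℕ) ℕ).summable_iff.mpr hFn
  refine Summable.of_nonneg_of_le (fun _ => norm_nonneg _) ?_ hnswap.prod
  intro mn
  rw [← (hfib mn).tsum_eq]
  exact norm_tsum_le_tsum_norm (hnswap.prod_factor mn)

/-- `exp(itP²) = Σ_{m,n≥0} I²_{m,n}(t) Sᵐ Tⁿ`, the double series being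
absolutely convergent in operator norm. -/
theorem statement_18
    {H : Type*} [NormedAddCommGroup H] [InnerProductSpace ℂ H] [CompleteSpace H]
    (e : HilbertBasis ℕ ℂ H)
    (S : H →L[ℂ] H) (hS : ∀ n : ℕ, S (e n) = e (n + 1))
    (T : H →L[ℂ] H) (hT : T = ContinuousLinearMap.adjoint S)
    (P : H →L[ℂ] H) (hP : P = Complex.I • (S - T)) (t : ℂ) :
    HasSum (fun mn : ℕ × ℕ => I2coef mn.1 mn.2 t • (S ^ mn.1 * T ^ mn.2))
        (NormedSpace.exp ((Complex.I * t) • (P ^ 2))) ∧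
      Summable (fun mn : ℕ × ℕ => ‖I2coef mn.1 mn.2 t • (S ^ mn.1 * T ^ mn.2)‖) := by
  have hTS : T * S = 1 := by
    refine ContinuousLinearMap.ext_on (s := Set.range e) ?_ ?_
    · exact (Submodule.dense_iff_topologicalClosure_eq_top).2 e.dense_span
    · rintro _ ⟨n, rfl⟩
      apply e.repr.injective
      ext m
      rw [e.repr_apply_apply, e.repr_apply_apply]
      simp only [mul_apply_eq_comp, one_apply_eq_self, hT]
      rw [ContinuousLinearMap.adjoint_inner_right, hS, hS,
        orthonormal_iff_ite.mp e.orthonormal, orthonormal_iff_ite.mp e.orthonormal]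
      simp
  have hS1 : ‖S‖ ≤ 1 := by
    have h := ContinuousLinearMap.norm_adjoint_comp_self S
    rw [← hT] at h
    have h2 : ‖T * S‖ ≤ 1 := by rw [hTS]; exact ContinuousLinearMap.norm_id_le
    have h3 : ‖S‖ * ‖S‖ ≤ 1 := by rw [← h]; exact h2
    nlinarith [norm_nonneg S]
  have hT1 : ‖T‖ ≤ 1 := by
    rw [hT]; simpa using hS1
  have hpow : ∀ (X : H →L[ℂ] H), ‖X‖ ≤ 1 → ∀ n : ℕ, ‖X ^ n‖ ≤ 1 := by
    intro X hX n
    induction n with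
    | zero => rw [pow_zero]; exact ContinuousLinearMap.norm_id_le
    | succ n ih =>
      rw [pow_succ]
      exact (norm_mul_le _ _).trans (mul_le_one₀ ih (norm_nonneg _) hX)
  have hST : ∀ m n : ℕ, ‖S ^ m * T ^ n‖ ≤ 1 := fun m n =>
    (norm_mul_le _ _).trans (mul_le_one₀ (hpow S hS1 m) (norm_nonneg _) (hpow T hT1 n))
  exact main_aux S T P hTS hST hP t
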